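/- Let $\gamma>0$, $n\in\mathbb{N}$, and $E=\bigcup_{j=1}^\infty\partial B(0,j^{-\gamma})\cup\{0\}\subset\mathbb{R}^n$. Then $E$ is weakly porous and its Muckenhoupt exponent equals $\Mu(E)=\min\{1,\frac{n\gamma}{1+\gamma}\}$; moreover $E$ is not porous. -/

import Mathlib

open MeasureTheory Metric Set

noncomputable section

/-- An axis-parallel half-open cube in `ℝⁿ`, given by its lower corner and side length. -/
structure Cube (n : ℕ) where
  a : EuclideanSpace ℝ (Fin n)
  l : ℝ
  pos : 0 < l

/-- The set of points of a cube. -/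
def Cube.set {n : ℕ} (P : Cube n) : Set (EuclideanSpace ℝ (Fin n)) :=
  {x | ∀ i, P.a i ≤ x i ∧ x i < P.a i + P.l}

/-- A weight: locally integrable and a.e. positive. -/
def IsWeight {n : ℕ} (w : EuclideanSpace ℝ (Fin n) → ℝ) : Prop :=
  LocallyIntegrable w volume ∧ ∀ᵐ x ∂(volume : Measure (EuclideanSpace ℝ (Fin n))), 0 < w x

/-- The `A₁` inequality with constant `C`, over all axis-parallel cubes. -/
def A1With {n : ℕ} (w : EuclideanSpace ℝ (Fin n) → ℝ) (C : ℝ) : Prop :=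
  ∀ P : Cube n, (⨍ x in P.set, w x) ≤ C * essInf w (volume.restrict P.set)

/-- Membership in the Muckenhoupt class `A₁`. -/
def MemA1 {n : ℕ} (w : EuclideanSpace ℝ (Fin n) → ℝ) : Prop :=
  IsWeight w ∧ ∃ C : ℝ, A1With w C

/-- The `A_p` inequality with constant `C`, over all axis-parallel cubes. -/
def ApWith {n : ℕ} (w : EuclideanSpace ℝ (Fin n) → ℝ) (p C : ℝ) : Prop :=
  ∀ P : Cube n,
    (⨍ x in P.set, w x) * (⨍ x in P.set, w x ^ (1 / (1 - p))) ^ (p - 1) ≤ C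

/-- Membership in the Muckenhoupt class `A_p`. -/
def MemAp {n : ℕ} (w : EuclideanSpace ℝ (Fin n) → ℝ) (p : ℝ) : Prop :=
  IsWeight w ∧ ∃ C : ℝ, ApWith w p C

/-- `Q` is a dyadic subcube of `P`. -/
def IsDyadicSubcube {n : ℕ} (P Q : Cube n) : Prop :=
  ∃ (j : ℕ) (k : Fin n → ℕ), (∀ i, k i < 2 ^ j) ∧
    Q.l = P.l / 2 ^ j ∧ ∀ i, Q.a i = P.a i + P.l * k i / 2 ^ j

/-- A cube is `E`-free if it does not meet `E`. -/
def EFree {n : ℕ} (E : Set (EuclideanSpace ℝ (Fin n))) (Q : Cube n) : Prop :=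
  Q.set ∩ E = ∅

/-- The measure `|𝓜(P)|` of a largest `E`-free dyadic subcube of `P`
(`0` if there is none). -/
def maxFree {n : ℕ} (E : Set (EuclideanSpace ℝ (Fin n))) (P : Cube n) : ℝ :=
  sSup {v : ℝ | ∃ Q : Cube n, IsDyadicSubcube P Q ∧ EFree E Q ∧ v = (volume Q.set).toReal}

/-- Weak porosity with constants `c`, `δ`. -/
def WeaklyPorousWith {n : ℕ} (E : Set (EuclideanSpace ℝ (Fin n))) (c δ : ℝ) : Prop :=
  ∀ P : Cube n, ∃ (N : ℕ) (Q : Fin N → Cube n),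
    (∀ k, IsDyadicSubcube P (Q k) ∧ EFree E (Q k)) ∧
    (∀ k m, k ≠ m → Disjoint (Q k).set (Q m).set) ∧
    (∀ k, δ * maxFree E P ≤ (volume (Q k).set).toReal) ∧
    c * (volume P.set).toReal ≤ ∑ k, (volume (Q k).set).toReal

/-- A set is weakly porous if it is weakly porous with some constants `0 < c, δ < 1`. -/
def WeaklyPorous {n : ℕ} (E : Set (EuclideanSpace ℝ (Fin n))) : Prop :=
  ∃ c δ : ℝ, 0 < c ∧ c < 1 ∧ 0 < δ ∧ δ < 1 ∧ WeaklyPorousWith E c δ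

/-- Porosity. -/
def Porous {n : ℕ} (E : Set (EuclideanSpace ℝ (Fin n))) : Prop :=
  ∃ c : ℝ, 0 < c ∧ ∀ (x : EuclideanSpace ℝ (Fin n)) (r : ℝ), 0 < r →
    ∃ y : EuclideanSpace ℝ (Fin n), ball y (c * r) ⊆ ball x r \ E

/-- The distance weight `dist(·,E)^{-α}`. -/
def distw {n : ℕ} (E : Set (EuclideanSpace ℝ (Fin n))) (α : ℝ)
    (x : EuclideanSpace ℝ (Fin n)) : ℝ :=
  infDist x E ^ (-α)

/-- `h_E(B(x,R))`: the supremum of radii `t` of balls contained in `B(x,R) \ E`. -/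
def hFree {n : ℕ} (E : Set (EuclideanSpace ℝ (Fin n))) (x : EuclideanSpace ℝ (Fin n))
    (R : ℝ) : ℝ :=
  sSup {t : ℝ | ∃ y ∈ ball x R, ball y t ⊆ ball x R \ E}

/-- The set of admissible exponents in the definition of the Muckenhoupt exponent. -/
def MuckSet {n : ℕ} (E : Set (EuclideanSpace ℝ (Fin n))) : Set ℝ :=
  {α : ℝ | ∃ C : ℝ, ∀ x ∈ E, ∀ R r : ℝ, 0 < r → r < hFree E x R → hFree E x R ≤ R →
    (volume (thickening r E ∩ ball x R)).toReal ≤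
      C * (hFree E x R / r) ^ (-α) * (volume (ball x R)).toReal}

open scoped Classical in
/-- The Muckenhoupt exponent of `E`. -/
def MuckExp {n : ℕ} (E : Set (EuclideanSpace ℝ (Fin n))) : ℝ :=
  if ∀ x ∈ E, ∀ R : ℝ, 0 < R → 0 < hFree E x R then sSup (MuckSet E) else 0

end

/-- The union of the spheres of radii `j^{-γ}`, `j = 1, 2, …`, together with the origin. -/
def sphereFamily (n : ℕ) (γ : ℝ) : Set (EuclideanSpace ℝ (Fin n)) :=
  (⋃ j : ℕ, sphere (0 : EuclideanSpace ℝ (Fin n)) (((j : ℝ) + 1) ^ (-γ))) ∪ {0}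

/-- The radius of the `j`-th sphere of the family. -/
noncomputable def sphereRadius (γ : ℝ) (j : ℕ) : ℝ := ((j : ℝ) + 1) ^ (-γ)

/-- The gap between consecutive spheres near radius `t` is comparable to `t ^ gapExponent γ`. -/
noncomputable def gapExponent (γ : ℝ) : ℝ := (1 + γ) / γ

theorem rpow_neg_sub_rpow_neg_bounds {p t : ℝ} (hp : 0 < p) (ht : 0 < t) :
    p * (t + 1) ^ (-p - 1) ≤ t ^ (-p) - (t + 1) ^ (-p) ∧
      t ^ (-p) - (t + 1) ^ (-p) ≤ p * t ^ (-p - 1) := by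
  obtain ⟨c, ⟨hc1, hc2⟩, hc⟩ := exists_hasDerivAt_eq_slope (fun x : ℝ => x ^ (-p))
    (fun x => -p * x ^ (-p - 1)) (lt_add_one t)
    (fun x hx => (Real.continuousAt_rpow_const x (-p)
      (Or.inl (by linarith [hx.1] : 0 < x).ne')).continuousWithinAt)
    (fun x hx => Real.hasDerivAt_rpow_const (Or.inl (by linarith [hx.1] : 0 < x).ne'))
  have hc' : t ^ (-p) - (t + 1) ^ (-p) = p * c ^ (-p - 1) := by
    simp only [add_sub_cancel_left, div_one] at hc
    linarith
  rw [hc']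
  constructor
  · exact mul_le_mul_of_nonneg_left
      (Real.rpow_le_rpow_of_nonpos (by linarith) hc2.le (by linarith)) hp.le
  · exact mul_le_mul_of_nonneg_left
      (Real.rpow_le_rpow_of_nonpos ht hc1.le (by linarith)) hp.le

theorem rpow_natCast_sub_succ_ge {p : ℝ} (hp : 0 < p) (j : ℕ) :
    p * 2 ^ (-p - 1) * ((j : ℝ) + 1) ^ (-p - 1) ≤
      ((j : ℝ) + 1) ^ (-p) - (((j + 1 : ℕ) : ℝ) + 1) ^ (-p) := by
  have hj : (0 : ℝ) ≤ j := j.cast_nonneg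
  push_cast
  refine le_trans ?_ (rpow_neg_sub_rpow_neg_bounds hp (by linarith : (0 : ℝ) < j + 1)).1
  rw [mul_assoc, ← Real.mul_rpow (by norm_num) (by linarith)]
  exact mul_le_mul_of_nonneg_left
    (Real.rpow_le_rpow_of_nonpos (by linarith) (by linarith) (by linarith)) hp.le

theorem sphereRadius_pos (γ : ℝ) (j : ℕ) : 0 < sphereRadius γ j :=
  Real.rpow_pos_of_pos (by positivity) _

@[simp] theorem sphereRadius_zero (γ : ℝ) : sphereRadius γ 0 = 1 := by
  simp [sphereRadius]

theorem sphereRadius_antitone {γ : ℝ} (hγ : 0 < γ) : Antitone (sphereRadius γ) := by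
  intro i j hij
  have : (i : ℝ) ≤ j := by exact_mod_cast hij
  exact Real.rpow_le_rpow_of_nonpos (by positivity) (by linarith) (by linarith)

theorem sphereRadius_le_one {γ : ℝ} (hγ : 0 < γ) (j : ℕ) : sphereRadius γ j ≤ 1 := by
  simpa using sphereRadius_antitone hγ (Nat.zero_le j)

theorem tendsto_sphereRadius {γ : ℝ} (hγ : 0 < γ) :
    Filter.Tendsto (sphereRadius γ) Filter.atTop (nhds 0) :=
  (tendsto_rpow_neg_atTop hγ).comp
    (Filter.tendsto_atTop_add_const_right _ _ tendsto_natCast_atTop_atTop)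

theorem sphereRadius_rpow (γ q : ℝ) (j : ℕ) :
    sphereRadius γ j ^ q = ((j : ℝ) + 1) ^ (-(γ * q)) := by
  rw [sphereRadius, ← Real.rpow_mul (by positivity), neg_mul]

theorem mul_gapExponent {γ : ℝ} (hγ : 0 < γ) : γ * gapExponent γ = 1 + γ := by
  unfold gapExponent; field_simp

theorem one_lt_gapExponent {γ : ℝ} (hγ : 0 < γ) : 1 < gapExponent γ := by
  unfold gapExponent; rw [lt_div_iff₀ hγ]; linarith

theorem sphereRadius_rpow_gapExponent {γ : ℝ} (hγ : 0 < γ) (j : ℕ) :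
    sphereRadius γ j ^ gapExponent γ = ((j : ℝ) + 1) ^ (-γ - 1) := by
  rw [sphereRadius_rpow, mul_gapExponent hγ]; congr 1; ring

theorem sphereRadius_sub_succ_ge {γ : ℝ} (hγ : 0 < γ) (j : ℕ) :
    γ * 2 ^ (-γ - 1) * sphereRadius γ j ^ gapExponent γ ≤
      sphereRadius γ j - sphereRadius γ (j + 1) := by
  rw [sphereRadius_rpow_gapExponent hγ]
  exact rpow_natCast_sub_succ_ge hγ j

theorem sphereRadius_sub_succ_le {γ : ℝ} (hγ : 0 < γ) (j : ℕ) :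
    sphereRadius γ j - sphereRadius γ (j + 1) ≤
      γ * 2 ^ (γ + 1) * sphereRadius γ (j + 1) ^ gapExponent γ := by
  have hj : (0 : ℝ) ≤ j := j.cast_nonneg
  have h := (rpow_neg_sub_rpow_neg_bounds hγ (by linarith : (0 : ℝ) < j + 1)).2
  rw [sphereRadius_rpow_gapExponent hγ]
  unfold sphereRadius
  push_cast
  refine h.trans ?_
  have h2 : (2 : ℝ) ^ (γ + 1) = (1 / 2) ^ (-γ - 1) := by
    rw [one_div, Real.inv_rpow (by norm_num), ← Real.rpow_neg (by norm_num)]; congr 1; ring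
  rw [mul_assoc, h2, ← Real.mul_rpow (by norm_num) (by linarith)]
  exact mul_le_mul_of_nonneg_left
    (Real.rpow_le_rpow_of_nonpos (by linarith) (by linarith) (by linarith)) hγ.le

/-- The constant in the upper bound for the distance to the family of spheres. -/
noncomputable def gapConst (γ : ℝ) : ℝ := max 1 (γ * 2 ^ (γ + 1))

theorem one_le_gapConst (γ : ℝ) : 1 ≤ gapConst γ := le_max_left _ _

theorem exists_sphereRadius_near {γ t : ℝ} (hγ : 0 < γ) (ht : 0 < t) :
    ∃ j, |t - sphereRadius γ j| ≤ gapConst γ * t ^ gapExponent γ := by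
  classical
  rcases le_or_gt t 1 with h1 | h1
  · have hex : ∃ j, sphereRadius γ j < t := ((tendsto_sphereRadius hγ).eventually_lt_const ht).exists
    obtain ⟨j, hj⟩ : ∃ j, Nat.find hex = j + 1 := by
      refine Nat.exists_eq_succ_of_ne_zero fun h0 => ?_
      have := Nat.find_spec hex
      rw [h0, sphereRadius_zero] at this
      linarith
    have hlt := Nat.find_spec hex
    rw [hj] at hlt
    have hge : t ≤ sphereRadius γ j := not_lt.1 (Nat.find_min hex (by omega))
    refine ⟨j + 1, ?_⟩
    rw [abs_of_pos (by linarith)]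
    calc t - sphereRadius γ (j + 1) ≤ sphereRadius γ j - sphereRadius γ (j + 1) := by linarith
      _ ≤ γ * 2 ^ (γ + 1) * sphereRadius γ (j + 1) ^ gapExponent γ := sphereRadius_sub_succ_le hγ j
      _ ≤ gapConst γ * t ^ gapExponent γ := by
        have := one_le_gapConst γ
        have := one_lt_gapExponent hγ
        have := sphereRadius_pos γ (j + 1)
        gcongr
        exact le_max_right _ _
  · refine ⟨0, ?_⟩
    rw [sphereRadius_zero, abs_of_pos (by linarith)]
    have : t ≤ t ^ gapExponent γ := by
      simpa using Real.rpow_le_rpow_of_exponent_le h1.le (one_lt_gapExponent hγ).le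
    nlinarith [one_le_gapConst γ]

theorem sphereFamily_eq_preimage (n : ℕ) (γ : ℝ) :
    sphereFamily n γ = norm ⁻¹' insert 0 (range (sphereRadius γ)) := by
  ext x
  simp only [sphereFamily, sphereRadius, mem_union, mem_iUnion, mem_sphere_zero_iff_norm,
    mem_singleton_iff, mem_preimage, mem_insert_iff, mem_range, norm_eq_zero, eq_comm (b := ‖x‖),
    or_comm]

theorem zero_mem_sphereFamily (n : ℕ) (γ : ℝ) : 0 ∈ sphereFamily n γ := by
  simp [sphereFamily_eq_preimage]

theorem isClosed_sphereFamily (n : ℕ) {γ : ℝ} (hγ : 0 < γ) : IsClosed (sphereFamily n γ) := by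
  rw [sphereFamily_eq_preimage]
  exact (tendsto_sphereRadius hγ).isCompact_insert_range.isClosed.preimage continuous_norm

theorem volume_sphereFamily {n : ℕ} (hn : 1 ≤ n) (γ : ℝ) : volume (sphereFamily n γ) = 0 := by
  have : Nonempty (Fin n) := ⟨⟨0, hn⟩⟩
  refine measure_union_null (measure_iUnion_null fun j => ?_) (measure_singleton _)
  exact Measure.addHaar_sphere_of_ne_zero _ _ (sphereRadius_pos γ j).ne'

theorem exists_mem_sphereFamily_dist_eq {n : ℕ} (γ : ℝ) {y : EuclideanSpace ℝ (Fin n)}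
    (hy : y ≠ 0) (j : ℕ) : ∃ e ∈ sphereFamily n γ, dist y e = |‖y‖ - sphereRadius γ j| := by
  have hy0 : 0 < ‖y‖ := norm_pos_iff.2 hy
  refine ⟨(sphereRadius γ j / ‖y‖) • y, ?_, ?_⟩
  · rw [sphereFamily_eq_preimage]
    refine Or.inr ⟨j, ?_⟩
    rw [norm_smul, Real.norm_of_nonneg (div_nonneg (sphereRadius_pos γ j).le hy0.le),
      div_mul_cancel₀ _ hy0.ne']
  · have : y - (sphereRadius γ j / ‖y‖) • y = (1 - sphereRadius γ j / ‖y‖) • y := by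
      rw [sub_smul, one_smul]
    rw [dist_eq_norm, this, norm_smul, Real.norm_eq_abs, ← abs_of_pos hy0, ← abs_mul,
      abs_of_pos hy0, sub_mul, one_mul, div_mul_cancel₀ _ hy0.ne']

theorem exists_mem_sphereFamily_dist_le {n : ℕ} {γ : ℝ} (hγ : 0 < γ)
    (y : EuclideanSpace ℝ (Fin n)) :
    ∃ e ∈ sphereFamily n γ, dist y e ≤ gapConst γ * ‖y‖ ^ gapExponent γ := by
  rcases eq_or_ne y 0 with rfl | hy
  · refine ⟨0, zero_mem_sphereFamily n γ, ?_⟩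
    rw [dist_self]
    have := one_le_gapConst γ
    positivity
  · obtain ⟨j, hj⟩ := exists_sphereRadius_near hγ (norm_pos_iff.2 hy)
    obtain ⟨e, he, hd⟩ := exists_mem_sphereFamily_dist_eq γ hy j
    exact ⟨e, he, hd.trans_le hj⟩

theorem le_of_ball_disjoint_sphereFamily {n : ℕ} {γ t T : ℝ} (hγ : 0 < γ)
    {y : EuclideanSpace ℝ (Fin n)} (hy : ‖y‖ ≤ T) (h : Disjoint (ball y t) (sphereFamily n γ)) :
    t ≤ gapConst γ * T ^ gapExponent γ := by
  obtain ⟨e, he, hd⟩ := exists_mem_sphereFamily_dist_le hγ y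
  have h1 : t ≤ dist y e := by
    by_contra! hlt
    exact h.notMem_of_mem_right he (by rwa [mem_ball, dist_comm])
  have := one_le_gapConst γ
  have := one_lt_gapExponent hγ
  exact h1.trans (hd.trans (by gcongr))

theorem volume_real_ball {n : ℕ} (x : EuclideanSpace ℝ (Fin n)) {R : ℝ} (hR : 0 < R) :
    volume.real (ball x R) = R ^ n * volume.real (ball (0 : EuclideanSpace ℝ (Fin n)) 1) := by
  rw [measureReal_def, Measure.addHaar_ball_of_pos _ _ hR, ENNReal.toReal_mul,
    ENNReal.toReal_ofReal (by positivity), finrank_euclideanSpace_fin, measureReal_def]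

theorem volume_real_unitBall_pos (n : ℕ) :
    0 < volume.real (ball (0 : EuclideanSpace ℝ (Fin n)) 1) :=
  ENNReal.toReal_pos (measure_ball_pos _ _ one_pos).ne' measure_ball_lt_top.ne

/-- The open shell of points whose norm is within `r` of `s`. -/
def shell (n : ℕ) (s r : ℝ) : Set (EuclideanSpace ℝ (Fin n)) := {y | |‖y‖ - s| < r}

theorem norm_add_smul_ge {E : Type*} [NormedAddCommGroup E] [InnerProductSpace ℝ E] {x y : E}
    {t : ℝ} (hx : x ≠ 0) (hxy : dist y x ≤ ‖x‖ / 4) (ht : 0 ≤ t) :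
    ‖y‖ + t / 2 ≤ ‖y + t • (‖x‖⁻¹ • x)‖ := by
  have hx0 : 0 < ‖x‖ := norm_pos_iff.2 hx
  have hin : ‖x‖ * ‖y‖ ≤ 2 * inner ℝ x y := by
    have h1 := norm_sub_sq_real x y
    rw [dist_comm, dist_eq_norm] at hxy
    have h2 := pow_le_pow_left₀ (norm_nonneg _) hxy 2
    nlinarith [sq_nonneg (‖x‖ - ‖y‖), sq_nonneg (‖x‖ - 2 * ‖y‖)]
  have hu : ‖y‖ ≤ 2 * inner ℝ y (‖x‖⁻¹ • x) := by
    rw [inner_smul_right, real_inner_comm, ← mul_assoc, mul_comm 2, mul_assoc, inv_mul_eq_div,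
      le_div_iff₀ hx0]
    linarith
  have hu1 : ‖‖x‖⁻¹ • x‖ = 1 := norm_smul_inv_norm (𝕜 := ℝ) hx
  refine le_of_sq_le_sq ?_ (norm_nonneg _)
  rw [norm_add_sq_real, inner_smul_right, norm_smul, hu1, Real.norm_of_nonneg ht]
  nlinarith [mul_le_mul_of_nonneg_left hu ht, norm_nonneg y, sq_nonneg t]

theorem volume_real_ball_inter_shell_le {n : ℕ} {x : EuclideanSpace ℝ (Fin n)} {R r : ℝ}
    (hR : 0 < R) (hRx : R ≤ ‖x‖ / 4) (hr : 0 < r) (s : ℝ) :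
    volume.real (ball x R ∩ shell n s r) ≤
      4 * 2 ^ n * volume.real (ball (0 : EuclideanSpace ℝ (Fin n)) 1) * (r / R) * R ^ n := by
  have hx : x ≠ 0 := by
    rintro rfl
    rw [norm_zero] at hRx
    linarith
  set u : EuclideanSpace ℝ (Fin n) := ‖x‖⁻¹ • x with hu
  have hu1 : ‖u‖ = 1 := norm_smul_inv_norm (𝕜 := ℝ) hx
  set S := ball x R ∩ shell n s r with hS
  have hSm : MeasurableSet S :=
    measurableSet_ball.inter (measurableSet_lt (by fun_prop) measurable_const)
  have hSfin : volume S ≠ ⊤ := measure_ne_top_of_subset inter_subset_left measure_ball_lt_top.ne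
  set K := ⌊R / (4 * r)⌋₊ with hK
  set A : ℕ → Set (EuclideanSpace ℝ (Fin n)) := fun k => (fun y => (-(4 * r * k)) • u + y) ⁻¹' S
  have hAv (k : ℕ) : volume.real (A k) = volume.real S := by
    simp only [A, measureReal_def, measure_preimage_add]
  have hAm (k : ℕ) : MeasurableSet (A k) := (measurable_const_add _) hSm
  have hlt : ∀ k l : ℕ, k < l → Disjoint (A k) (A l) := by
    intro k l hkl
    refine disjoint_left.2 fun z hk hl => ?_
    obtain ⟨-, hk2 : |‖-(4 * r * ↑k) • u + z‖ - s| < r⟩ := hk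
    obtain ⟨hl1, hl2 : |‖-(4 * r * ↑l) • u + z‖ - s| < r⟩ := hl
    have ht : 4 * r ≤ 4 * r * ((l : ℝ) - k) := by
      have : (k : ℝ) + 1 ≤ l := by exact_mod_cast hkl
      nlinarith
    have h := norm_add_smul_ge hx (hl1.le.trans hRx) (by linarith : 0 ≤ 4 * r * ((l : ℝ) - k))
    have he : -(4 * r * ↑l) • u + z + (4 * r * (↑l - ↑k)) • ‖x‖⁻¹ • x
        = -(4 * r * ↑k) • u + z := by
      rw [← hu]; module
    rw [he] at h
    have h1 := (abs_lt.1 hk2).2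
    have h2 := (abs_lt.1 hl2).1
    linarith
  have hdis : Set.PairwiseDisjoint (↑(Finset.range (K + 1)) : Set ℕ) A := fun k _ l _ hkl =>
    (lt_or_gt_of_ne hkl).elim (hlt k l) fun h => (hlt l k h).symm
  have hsub : (⋃ k ∈ Finset.range (K + 1), A k) ⊆ ball x (2 * R) := by
    refine iUnion₂_subset fun k hk z hz => ?_
    have hkK : (k : ℝ) ≤ R / (4 * r) :=
      (Nat.cast_le.2 (Nat.lt_succ_iff.1 (Finset.mem_range.1 hk))).trans
        (Nat.floor_le (by positivity))
    rw [le_div_iff₀ (by positivity)] at hkK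
    have h1 : dist (-(4 * r * ↑k) • u + z) x < R := hz.1
    have h2 : dist z (-(4 * r * ↑k) • u + z) = 4 * r * k := by
      rw [dist_eq_norm, show z - (-(4 * r * ↑k) • u + z) = (4 * r * (k : ℝ)) • u by module,
        norm_smul, hu1, mul_one, Real.norm_of_nonneg (by positivity)]
    rw [mem_ball]
    linarith [dist_triangle z (-(4 * r * ↑k) • u + z) x]
  have hsum := measureReal_biUnion_finset (μ := volume) hdis (fun k _ => hAm k)
    (fun k _ => by simpa only [A, measure_preimage_add] using hSfin)
  simp only [hAv, Finset.sum_const, Finset.card_range, nsmul_eq_mul] at hsum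
  have hle := measureReal_mono hsub (measure_ball_lt_top (μ := volume)).ne
  rw [hsum, volume_real_ball x (by positivity)] at hle
  have hKR : R / (4 * r) ≤ ((K + 1 : ℕ) : ℝ) := by
    push_cast; exact (Nat.lt_floor_add_one _).le
  have := (mul_le_mul_of_nonneg_right hKR (measureReal_nonneg (μ := volume) (s := S))).trans hle
  rw [div_mul_eq_mul_div, div_le_iff₀ (by positivity)] at this
  rw [show 4 * 2 ^ n * volume.real (ball (0 : EuclideanSpace ℝ (Fin n)) 1) * (r / R) * R ^ n =
    ((2 * R) ^ n * volume.real (ball (0 : EuclideanSpace ℝ (Fin n)) 1) * (4 * r)) / R by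
      rw [mul_pow]; field_simp, le_div_iff₀ hR]
  linarith

theorem volume_real_shell_le {n : ℕ} (hn : n ≠ 0) {s r : ℝ} (hr : 0 < r) (hrs : r ≤ s) :
    volume.real (shell n s r) ≤
      n * 2 ^ n * volume.real (ball (0 : EuclideanSpace ℝ (Fin n)) 1) * (r * s ^ (n - 1)) := by
  have hω := volume_real_unitBall_pos n
  have hsub : shell n s r ⊆ ball 0 (s + r) \ ball 0 (s - r) := by
    intro y hy
    have := abs_lt.1 (show |‖y‖ - s| < r from hy)
    simp only [mem_sdiff, mem_ball_zero_iff]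
    constructor <;> linarith
  rcases n with _ | n
  · exact absurd rfl hn
  have hb : volume.real (ball (0 : EuclideanSpace ℝ (Fin (n + 1))) (s - r)) =
      (s - r) ^ (n + 1) * volume.real (ball (0 : EuclideanSpace ℝ (Fin (n + 1))) 1) := by
    rcases hrs.eq_or_lt with rfl | h
    · simp
    · exact volume_real_ball 0 (by linarith)
  refine (measureReal_mono hsub
    (measure_ne_top_of_subset sdiff_subset measure_ball_lt_top.ne)).trans ?_
  rw [measureReal_sdiff (ball_subset_ball (by linarith)) measurableSet_ball
    , volume_real_ball 0 (by linarith), hb, ← sub_mul]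
  have hs0 : 0 ≤ s + r := by linarith
  have hs : s + r ≤ 2 * s := by linarith
  have h1 := (le_abs_self _).trans (abs_pow_sub_pow_le (a := s + r) (b := s - r) (n := n + 1))
  rw [show s + r - (s - r) = 2 * r by ring, abs_of_pos (by linarith : 0 < s + r),
    abs_of_nonneg (by linarith : 0 ≤ s - r), abs_of_pos (by linarith : 0 < 2 * r),
    max_eq_left (by linarith), Nat.add_sub_cancel] at h1
  calc _ ≤ (2 * r * ↑(n + 1) * (2 * s) ^ n) *
        volume.real (ball (0 : EuclideanSpace ℝ (Fin (n + 1))) 1) := by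
          gcongr
          exact h1.trans (by gcongr)
    _ = _ := by rw [mul_pow, Nat.add_sub_cancel]; ring

theorem sum_le_of_le_sub_succ {b f : ℕ → ℝ} (hb : Antitone b) {N : ℕ} {S : Finset ℕ}
    (hS : S ⊆ Finset.range N) (hf : ∀ j ∈ S, f j ≤ b j - b (j + 1)) :
    ∑ j ∈ S, f j ≤ b 0 - b N :=
  calc ∑ j ∈ S, f j ≤ ∑ j ∈ S, (b j - b (j + 1)) := Finset.sum_le_sum hf
    _ ≤ ∑ j ∈ Finset.range N, (b j - b (j + 1)) :=
      Finset.sum_le_sum_of_subset_of_nonneg hS fun j _ _ => sub_nonneg.2 (hb j.le_succ)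
    _ = b 0 - b N := Finset.sum_range_sub' b N

theorem norm_lt_or_mem_shell_of_mem_thickening {n : ℕ} {γ r : ℝ} {y : EuclideanSpace ℝ (Fin n)}
    (hy : y ∈ thickening r (sphereFamily n γ)) :
    ‖y‖ < r ∨ ∃ j, y ∈ shell n (sphereRadius γ j) r := by
  obtain ⟨e, he, hd⟩ := mem_thickening_iff.1 hy
  have h := (abs_norm_sub_norm_le y e).trans_lt (dist_eq_norm y e ▸ hd)
  rw [sphereFamily_eq_preimage] at he
  rcases he with h0 | ⟨j, hj⟩
  · rw [h0, sub_zero, abs_of_nonneg (norm_nonneg _)] at h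
    exact Or.inl h
  · exact Or.inr ⟨j, by rw [hj]; exact h⟩

/-- The scale of the largest free balls in `ball x R`, up to constants. -/
noncomputable def freeScale {n : ℕ} (γ : ℝ) (x : EuclideanSpace ℝ (Fin n)) (R : ℝ) : ℝ :=
  min R ((‖x‖ + R) ^ gapExponent γ)

theorem freeScale_pos {n : ℕ} (γ : ℝ) (x : EuclideanSpace ℝ (Fin n)) {R : ℝ} (hR : 0 < R) :
    0 < freeScale γ x R :=
  lt_min hR (Real.rpow_pos_of_pos (by positivity) _)

theorem freeScale_le {n : ℕ} (γ : ℝ) (x : EuclideanSpace ℝ (Fin n)) (R : ℝ) :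
    freeScale γ x R ≤ R := min_le_left _ _

theorem card_sphereRadius_near_le {n : ℕ} {γ : ℝ} (hγ : 0 < γ) :
    ∃ C : ℝ, 0 < C ∧ ∀ (x : EuclideanSpace ℝ (Fin n)) (R : ℝ) (N : ℕ), 0 < R → R ≤ ‖x‖ / 4 →
      (({j ∈ Finset.range N | |sphereRadius γ j - ‖x‖| < 2 * R}.card : ℕ) : ℝ) ≤
        C * (R / freeScale γ x R) := by
  have hκ := one_lt_gapExponent hγ
  set c : ℝ := γ * 2 ^ (-γ - 1) * (4 ^ gapExponent γ)⁻¹ with hc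
  have hc0 : 0 < c := by positivity
  refine ⟨(4 + c) / c, by positivity, fun x R N hR hRx => ?_⟩
  have hH := freeScale_pos γ x hR
  have hHR := freeScale_le γ x R
  set H := freeScale γ x R with hHdef
  set S := {j ∈ Finset.range N | |sphereRadius γ j - ‖x‖| < 2 * R} with hS
  set b : ℕ → ℝ := fun j => max (‖x‖ - 2 * R - c * H) (min (sphereRadius γ j) (‖x‖ + 2 * R)) with hb
  have hcH : 0 < c * H := by positivity
  have hba : Antitone b := fun i j hij =>
    max_le_max le_rfl (min_le_min (sphereRadius_antitone hγ hij) le_rfl)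
  have hsum := sum_le_of_le_sub_succ (f := fun _ => c * H) hba (Finset.filter_subset _ _ : S ⊆ _)
    (by
      intro j hj
      have hj' := abs_lt.1 (Finset.mem_filter.1 hj).2
      have hgap : c * H ≤ sphereRadius γ j - sphereRadius γ (j + 1) := by
        refine le_trans ?_ (sphereRadius_sub_succ_ge hγ j)
        have h1 : H ≤ 4 ^ gapExponent γ * sphereRadius γ j ^ gapExponent γ := by
          rw [← Real.mul_rpow (by norm_num) (sphereRadius_pos γ j).le]
          refine (min_le_right _ _).trans (Real.rpow_le_rpow (by positivity) ?_ (by linarith))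
          linarith [hj'.1]
        calc c * H ≤ c * (4 ^ gapExponent γ * sphereRadius γ j ^ gapExponent γ) := by gcongr
          _ = _ := by rw [hc]; field_simp
      have h1 : sphereRadius γ j ≤ b j :=
        le_max_of_le_right (le_min le_rfl (by linarith [hj'.2]))
      have h2 : b (j + 1) ≤ sphereRadius γ j - c * H :=
        max_le (by linarith [hj'.1]) ((min_le_left _ _).trans (by linarith))
      linarith)
  have hb0 : b 0 ≤ ‖x‖ + 2 * R := max_le (by linarith) (min_le_right _ _)
  have hbN : ‖x‖ - 2 * R - c * H ≤ b N := le_max_left _ _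
  rw [Finset.sum_const, nsmul_eq_mul] at hsum
  rw [div_mul_div_comm, le_div_iff₀ hcH]
  nlinarith

theorem volume_thickening_inter_ball_le_of_le_norm {n : ℕ} {γ : ℝ} (hγ : 0 < γ) :
    ∃ C : ℝ, 0 < C ∧ ∀ (x : EuclideanSpace ℝ (Fin n)) (R r : ℝ), 0 < R → R ≤ ‖x‖ / 4 → 0 < r →
      r ≤ freeScale γ x R →
      volume.real (thickening r (sphereFamily n γ) ∩ ball x R) ≤
        C * (r / freeScale γ x R) * R ^ n := by
  obtain ⟨C, hC, hcard⟩ := card_sphereRadius_near_le (n := n) hγ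
  have hω := volume_real_unitBall_pos n
  set D := 4 * 2 ^ n * volume.real (ball (0 : EuclideanSpace ℝ (Fin n)) 1) with hD
  have hD0 : 0 < D := by positivity
  refine ⟨C * D, by positivity, fun x R r hR hRx hr hrH => ?_⟩
  have hH := freeScale_pos γ x hR
  have hrR := hrH.trans (freeScale_le γ x R)
  obtain ⟨N, hN⟩ := Filter.eventually_atTop.1
    ((tendsto_sphereRadius hγ).eventually_lt_const (by linarith : 0 < ‖x‖ - 2 * R))
  set S := {j ∈ Finset.range N | |sphereRadius γ j - ‖x‖| < 2 * R} with hS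
  have hsub : thickening r (sphereFamily n γ) ∩ ball x R ⊆
      ⋃ j ∈ S, ball x R ∩ shell n (sphereRadius γ j) r := by
    rintro y ⟨hy, hyx⟩
    have hyx' := abs_lt.1 ((abs_norm_sub_norm_le y x).trans_lt (dist_eq_norm y x ▸ mem_ball.1 hyx))
    rcases norm_lt_or_mem_shell_of_mem_thickening hy with h0 | ⟨j, hj⟩
    · linarith [hyx'.1]
    · have hj' := abs_lt.1 (show |‖y‖ - sphereRadius γ j| < r from hj)
      refine mem_iUnion₂.2 ⟨j, ?_, hyx, hj⟩
      have habs : |sphereRadius γ j - ‖x‖| < 2 * R :=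
        abs_lt.2 ⟨by linarith [hyx'.1, hj'.2], by linarith [hyx'.2, hj'.1]⟩
      refine Finset.mem_filter.2 ⟨Finset.mem_range.2 ?_, habs⟩
      by_contra! hNj
      linarith [hN j hNj, (abs_lt.1 habs).1]
  calc volume.real (thickening r (sphereFamily n γ) ∩ ball x R)
      ≤ volume.real (⋃ j ∈ S, ball x R ∩ shell n (sphereRadius γ j) r) :=
        measureReal_mono hsub (measure_ne_top_of_subset
          (iUnion₂_subset fun _ _ => inter_subset_left) measure_ball_lt_top.ne)
    _ ≤ ∑ j ∈ S, volume.real (ball x R ∩ shell n (sphereRadius γ j) r) :=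
        measureReal_biUnion_finset_le _ _
    _ ≤ ∑ j ∈ S, D * (r / R) * R ^ n :=
        Finset.sum_le_sum fun j _ => volume_real_ball_inter_shell_le hR hRx hr _
    _ = S.card * (D * (r / R) * R ^ n) := by rw [Finset.sum_const, nsmul_eq_mul]
    _ ≤ C * (R / freeScale γ x R) * (D * (r / R) * R ^ n) := by
        gcongr
        exact hcard x R N hR hRx
    _ = C * D * (r / freeScale γ x R) * R ^ n := by field_simp

theorem sum_sphereRadius_rpow_le {γ δ : ℝ} (hγ : 0 < γ) (hδ : 0 < δ) :
    ∃ C : ℝ, 0 < C ∧ ∀ (U : ℝ) (N : ℕ), 0 < U →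
      ∑ j ∈ Finset.range N with sphereRadius γ j < U,
        sphereRadius γ j ^ (δ + 1 / γ) ≤ C * U ^ δ := by
  have hγδ : 0 < γ * δ := by positivity
  set c : ℝ := γ * δ * 2 ^ (-(γ * δ) - 1) with hc
  have hc0 : 0 < c := by positivity
  refine ⟨c⁻¹, by positivity, fun U N hU => ?_⟩
  set b : ℕ → ℝ := fun j => c⁻¹ * min (sphereRadius γ j ^ δ) (U ^ δ) with hb
  have hba : Antitone b := fun i j hij => mul_le_mul_of_nonneg_left (min_le_min
    (Real.rpow_le_rpow (sphereRadius_pos γ j).le (sphereRadius_antitone hγ hij) hδ.le) le_rfl)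
    (by positivity)
  have hsum := sum_le_of_le_sub_succ (f := fun j => sphereRadius γ j ^ (δ + 1 / γ)) hba
    (Finset.filter_subset (fun j => sphereRadius γ j < U) (Finset.range N))
    (by
      intro j hj
      have hj' := (Finset.mem_filter.1 hj).2
      have h1 : b j = c⁻¹ * sphereRadius γ j ^ δ := by
        simp only [hb]
        rw [min_eq_left (Real.rpow_le_rpow (sphereRadius_pos γ j).le hj'.le hδ.le)]
      have h2 : b (j + 1) ≤ c⁻¹ * sphereRadius γ (j + 1) ^ δ :=
        mul_le_mul_of_nonneg_left (min_le_left _ _) (by positivity)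
      have h3 := rpow_natCast_sub_succ_ge hγδ j
      rw [← sphereRadius_rpow, ← sphereRadius_rpow] at h3
      have h4 : sphereRadius γ j ^ (δ + 1 / γ) = ((j : ℝ) + 1) ^ (-(γ * δ) - 1) := by
        rw [sphereRadius_rpow]; congr 1; field_simp; ring
      rw [h1, h4]
      refine le_trans ?_ (sub_le_sub_left h2 _)
      rw [← mul_sub, inv_mul_eq_div, le_div_iff₀ hc0]
      linarith)
  refine hsum.trans ?_
  have h0 : b 0 ≤ c⁻¹ * U ^ δ := mul_le_mul_of_nonneg_left (min_le_right _ _) (by positivity)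
  have hN : 0 ≤ b N := mul_nonneg (by positivity)
    (le_min (Real.rpow_nonneg (sphereRadius_pos γ N).le _) (by positivity))
  linarith

theorem volume_shell_near_free_scale_le {n : ℕ} (hn : n ≠ 0) {γ α r : ℝ} (hγ : 0 < γ)
    (hα : α ≤ 1) (hr : 0 < r) {j : ℕ} (hj : r ≤ sphereRadius γ j ^ gapExponent γ) :
    volume.real (shell n (sphereRadius γ j) r) ≤
      n * 2 ^ n * volume.real (ball (0 : EuclideanSpace ℝ (Fin n)) 1) * r ^ α *
        sphereRadius γ j ^ (n - α * gapExponent γ + 1 / γ) := by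
  have hs := sphereRadius_pos γ j
  have hκ := one_lt_gapExponent hγ
  have hω := volume_real_unitBall_pos n
  have hrs : r ≤ sphereRadius γ j := hj.trans (by
    simpa using Real.rpow_le_rpow_of_exponent_ge hs (sphereRadius_le_one hγ j) hκ.le)
  refine (volume_real_shell_le hn hr hrs).trans ?_
  rw [mul_assoc _ (r ^ α)]
  refine mul_le_mul_of_nonneg_left ?_ (by positivity)
  have h1 : r ^ (1 - α) ≤ sphereRadius γ j ^ (gapExponent γ * (1 - α)) := by
    rw [Real.rpow_mul hs.le]
    exact Real.rpow_le_rpow hr.le hj (by linarith)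
  calc r * sphereRadius γ j ^ (n - 1)
      = r ^ α * (r ^ (1 - α) * sphereRadius γ j ^ ((n - 1 : ℕ) : ℝ)) := by
        rw [← mul_assoc, ← Real.rpow_add hr, Real.rpow_natCast, add_sub_cancel, Real.rpow_one]
    _ ≤ r ^ α * (sphereRadius γ j ^ (gapExponent γ * (1 - α)) *
          sphereRadius γ j ^ ((n - 1 : ℕ) : ℝ)) := by gcongr
    _ = r ^ α * sphereRadius γ j ^ (n - α * gapExponent γ + 1 / γ) := by
        rw [← Real.rpow_add hs]
        congr 2
        rw [Nat.cast_pred (Nat.pos_of_ne_zero hn)]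
        unfold gapExponent
        field_simp
        ring

theorem volume_thickening_inter_ball_le_of_norm_le {n : ℕ} (hn : n ≠ 0) {γ α : ℝ} (hγ : 0 < γ)
    (hα0 : 0 < α) (hα1 : α ≤ 1) (hα : α * gapExponent γ < n) :
    ∃ C : ℝ, 0 < C ∧ ∀ (x : EuclideanSpace ℝ (Fin n)) (R r : ℝ), 0 < R → ‖x‖ ≤ 4 * R → 0 < r →
      r ≤ freeScale γ x R →
      volume.real (thickening r (sphereFamily n γ) ∩ ball x R) ≤
        C * (r / freeScale γ x R) ^ α * R ^ n := by
  have hκ := one_lt_gapExponent hγ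
  set κ := gapExponent γ with hκdef
  have hκ0 : 0 < κ := by linarith
  have hn0 : (0 : ℝ) < n := by positivity
  obtain ⟨C, hC, hsum⟩ := sum_sphereRadius_rpow_le (δ := n - α * κ) hγ (by linarith)
  have hω := volume_real_unitBall_pos n
  set ω := volume.real (ball (0 : EuclideanSpace ℝ (Fin n)) 1) with hωdef
  set D := n * 2 ^ n * ω with hD
  have hD0 : 0 < D := by positivity
  refine ⟨7 ^ n * ω + D * C * 6 ^ n, by positivity, fun x R r hR hxR hr hrH => ?_⟩
  have hH := freeScale_pos γ x hR
  have hHR := freeScale_le γ x R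
  have hH6 : freeScale γ x R ≤ (6 * R) ^ κ :=
    (min_le_right _ _).trans (Real.rpow_le_rpow (by positivity) (by linarith) hκ0.le)
  set H := freeScale γ x R with hHdef
  set τ := r ^ κ⁻¹ with hτ
  have hτ0 : 0 < τ := by positivity
  set q := r / H with hq
  have hq0 : 0 < q := by positivity
  have hq1 : q ≤ 1 := (div_le_one hH).2 hrH
  have hrq : r = q * H := by rw [hq]; field_simp
  obtain ⟨N, hN⟩ := Filter.eventually_atTop.1
    ((tendsto_sphereRadius hγ).eventually_lt_const hτ0)
  set S := {j ∈ Finset.range N | sphereRadius γ j < 6 * R} with hS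
  set S' := {j ∈ S | r ≤ sphereRadius γ j ^ κ} with hS'
  have hsub : thickening r (sphereFamily n γ) ∩ ball x R ⊆
      ball 0 (τ + r) ∪ ⋃ j ∈ S', shell n (sphereRadius γ j) r := by
    rintro y ⟨hy, hyx⟩
    have hyx' := abs_lt.1 ((abs_norm_sub_norm_le y x).trans_lt
      (dist_eq_norm y x ▸ mem_ball.1 hyx))
    rcases norm_lt_or_mem_shell_of_mem_thickening hy with h0 | ⟨j, hj⟩
    · left
      rw [mem_ball_zero_iff]
      linarith
    · have hj' := abs_lt.1 (show |‖y‖ - sphereRadius γ j| < r from hj)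
      rcases lt_or_ge (sphereRadius γ j) τ with h | h
      · left
        rw [mem_ball_zero_iff]
        linarith [hj'.2]
      · right
        refine mem_iUnion₂.2 ⟨j, Finset.mem_filter.2 ⟨Finset.mem_filter.2 ⟨?_, ?_⟩, ?_⟩, hj⟩
        · refine Finset.mem_range.2 ?_
          by_contra! hNj
          linarith [hN j hNj]
        · linarith [hj'.1, hyx'.2]
        · calc r = τ ^ κ := by rw [hτ, Real.rpow_inv_rpow hr.le hκ0.ne']
            _ ≤ sphereRadius γ j ^ κ := Real.rpow_le_rpow hτ0.le h hκ0.le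
  have hcore : volume.real (ball (0 : EuclideanSpace ℝ (Fin n)) (τ + r)) ≤
      7 ^ n * ω * q ^ α * R ^ n := by
    have h1 : τ ≤ q ^ (α / n) * (6 * R) := by
      calc τ ≤ (q * (6 * R) ^ κ) ^ κ⁻¹ :=
            Real.rpow_le_rpow hr.le (hrq.le.trans (by gcongr)) (by positivity)
        _ = q ^ κ⁻¹ * (6 * R) := by
            rw [Real.mul_rpow hq0.le (by positivity), Real.rpow_rpow_inv (by positivity) hκ0.ne']
        _ ≤ q ^ (α / n) * (6 * R) := by
            refine mul_le_mul_of_nonneg_right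
              (Real.rpow_le_rpow_of_exponent_ge hq0 hq1 ?_) (by positivity)
            rw [div_le_iff₀ hn0, inv_mul_eq_div, le_div_iff₀ hκ0]
            exact hα.le
    have h2 : r ≤ q ^ (α / n) * R := by
      have h3 : q ≤ q ^ (α / n) := by
        have : α / n ≤ 1 := by
          rw [div_le_one hn0]
          exact hα1.trans (by exact_mod_cast Nat.one_le_iff_ne_zero.2 hn)
        simpa using Real.rpow_le_rpow_of_exponent_ge hq0 hq1 this
      calc r = q * H := hrq
        _ ≤ q ^ (α / n) * R := by gcongr
    rw [volume_real_ball 0 (by positivity)]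
    calc (τ + r) ^ n * ω ≤ (q ^ (α / n) * (7 * R)) ^ n * ω := by
          gcongr
          linarith
      _ = 7 ^ n * ω * q ^ α * R ^ n := by
          rw [mul_pow, mul_pow, ← Real.rpow_natCast (q ^ (α / n)), ← Real.rpow_mul hq0.le,
            div_mul_cancel₀ _ hn0.ne']
          ring
  have hshells : ∑ j ∈ S', volume.real (shell n (sphereRadius γ j) r) ≤
      D * C * 6 ^ n * q ^ α * R ^ n := by
    have h6 : (6 * R) ^ ((n : ℝ) - α * κ) * H ^ α ≤ 6 ^ n * R ^ n := by
      calc (6 * R) ^ ((n : ℝ) - α * κ) * H ^ α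
          ≤ (6 * R) ^ ((n : ℝ) - α * κ) * ((6 * R) ^ κ) ^ α := by gcongr
        _ = 6 ^ n * R ^ n := by
            rw [← Real.rpow_mul (by positivity), ← Real.rpow_add (by positivity), ← mul_pow,
              ← Real.rpow_natCast]
            congr 1
            ring
    calc ∑ j ∈ S', volume.real (shell n (sphereRadius γ j) r)
        ≤ ∑ j ∈ S', D * r ^ α * sphereRadius γ j ^ (n - α * κ + 1 / γ) :=
          Finset.sum_le_sum fun j hj => volume_shell_near_free_scale_le hn hγ hα1 hr
            (Finset.mem_filter.1 hj).2
      _ ≤ ∑ j ∈ S, D * r ^ α * sphereRadius γ j ^ (n - α * κ + 1 / γ) :=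
          Finset.sum_le_sum_of_subset_of_nonneg (Finset.filter_subset _ _) fun j _ _ =>
            mul_nonneg (by positivity) (Real.rpow_nonneg (sphereRadius_pos γ j).le _)
      _ ≤ D * r ^ α * (C * (6 * R) ^ ((n : ℝ) - α * κ)) := by
          rw [← Finset.mul_sum]
          gcongr
          exact hsum (6 * R) N (by positivity)
      _ = D * C * q ^ α * ((6 * R) ^ ((n : ℝ) - α * κ) * H ^ α) := by
          rw [hrq, Real.mul_rpow hq0.le hH.le]
          ring
      _ ≤ D * C * q ^ α * (6 ^ n * R ^ n) := by gcongr
      _ = D * C * 6 ^ n * q ^ α * R ^ n := by ring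
  have hfin : volume (⋃ j ∈ S', shell n (sphereRadius γ j) r) ≠ ⊤ := by
    refine (measure_biUnion_lt_top S'.finite_toSet fun j _ => ?_).ne
    refine measure_lt_top_of_subset
      (s := ball (0 : EuclideanSpace ℝ (Fin n)) (sphereRadius γ j + r)) (fun y hy => ?_)
      (measure_ball_lt_top (μ := volume)).ne
    have := (abs_lt.1 (show |‖y‖ - sphereRadius γ j| < r from hy)).2
    rw [mem_ball_zero_iff]
    linarith
  calc volume.real (thickening r (sphereFamily n γ) ∩ ball x R)
      ≤ volume.real (ball 0 (τ + r) ∪ ⋃ j ∈ S', shell n (sphereRadius γ j) r) :=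
        measureReal_mono hsub (measure_union_ne_top measure_ball_lt_top.ne hfin)
    _ ≤ volume.real (ball (0 : EuclideanSpace ℝ (Fin n)) (τ + r)) +
          ∑ j ∈ S', volume.real (shell n (sphereRadius γ j) r) :=
        (measureReal_union_le _ _).trans
          (add_le_add_right (measureReal_biUnion_finset_le _ _) _)
    _ ≤ 7 ^ n * ω * q ^ α * R ^ n + D * C * 6 ^ n * q ^ α * R ^ n := add_le_add hcore hshells
    _ = _ := by ring

theorem volume_thickening_inter_ball_le {n : ℕ} (hn : n ≠ 0) {γ α : ℝ} (hγ : 0 < γ)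
    (hα0 : 0 < α) (hα1 : α ≤ 1) (hα : α * gapExponent γ < n) :
    ∃ C : ℝ, 0 < C ∧ ∀ (x : EuclideanSpace ℝ (Fin n)) (R r : ℝ), 0 < R → 0 < r →
      volume.real (thickening r (sphereFamily n γ) ∩ ball x R) ≤
        C * (r / freeScale γ x R) ^ α * R ^ n := by
  obtain ⟨C₁, hC₁, h₁⟩ := volume_thickening_inter_ball_le_of_le_norm (n := n) hγ
  obtain ⟨C₂, hC₂, h₂⟩ := volume_thickening_inter_ball_le_of_norm_le hn hγ hα0 hα1 hα
  have hω := volume_real_unitBall_pos n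
  set ω := volume.real (ball (0 : EuclideanSpace ℝ (Fin n)) 1) with hωdef
  refine ⟨C₁ + C₂ + ω, by positivity, fun x R r hR hr => ?_⟩
  have hH := freeScale_pos γ x hR
  have hq0 : 0 < r / freeScale γ x R := by positivity
  have hqα : 0 < (r / freeScale γ x R) ^ α := by positivity
  rcases le_or_gt r (freeScale γ x R) with hrH | hrH
  · have hq1 : r / freeScale γ x R ≤ 1 := (div_le_one hH).2 hrH
    rcases le_total R (‖x‖ / 4) with hx | hx
    · refine (h₁ x R r hR hx hr hrH).trans ?_
      gcongr
      · linarith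
      · simpa using Real.rpow_le_rpow_of_exponent_ge hq0 hq1 hα1
    · refine (h₂ x R r hR (by linarith) hr hrH).trans ?_
      gcongr
      linarith
  · have h1 : 1 ≤ (r / freeScale γ x R) ^ α :=
      Real.one_le_rpow ((one_le_div hH).2 hrH.le) hα0.le
    calc volume.real (thickening r (sphereFamily n γ) ∩ ball x R) ≤ volume.real (ball x R) :=
          measureReal_mono inter_subset_right measure_ball_lt_top.ne
      _ = ω * 1 * R ^ n := by rw [volume_real_ball x hR]; ring
      _ ≤ _ := by gcongr; linarith

theorem le_of_ball_subset_ball {n : ℕ} (hn : n ≠ 0) {x y : EuclideanSpace ℝ (Fin n)} {R t : ℝ}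
    (hR : 0 < R) (h : ball y t ⊆ ball x R) : t ≤ R := by
  by_contra! hlt
  have := measureReal_mono h (measure_ball_lt_top (μ := volume)).ne
  rw [volume_real_ball x hR, volume_real_ball y (hR.trans hlt)] at this
  exact absurd (pow_lt_pow_left₀ hlt hR.le hn)
    (le_of_mul_le_mul_right this (volume_real_unitBall_pos n)).not_gt

theorem le_of_mem_freeRadii {n : ℕ} (hn : n ≠ 0) {γ R t : ℝ} (hγ : 0 < γ)
    {x y : EuclideanSpace ℝ (Fin n)} (hR : 0 < R) (hy : y ∈ ball x R)
    (h : ball y t ⊆ ball x R \ sphereFamily n γ) : t ≤ gapConst γ * freeScale γ x R := by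
  have hG := one_le_gapConst γ
  have h1 : t ≤ R := le_of_ball_subset_ball hn hR (h.trans sdiff_subset)
  have h2 : ‖y‖ ≤ ‖x‖ + R := by
    have := norm_sub_norm_le y x
    rw [← dist_eq_norm] at this
    linarith [mem_ball.1 hy]
  have h3 := le_of_ball_disjoint_sphereFamily hγ h2 (disjoint_sdiff_left.mono_left h)
  rcases min_choice R ((‖x‖ + R) ^ gapExponent γ) with h | h
  · rw [freeScale, h]
    nlinarith
  · rwa [freeScale, h]

theorem hFree_sphereFamily_le {n : ℕ} (hn : n ≠ 0) {γ R : ℝ} (hγ : 0 < γ)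
    (x : EuclideanSpace ℝ (Fin n)) (hR : 0 < R) :
    hFree (sphereFamily n γ) x R ≤ gapConst γ * freeScale γ x R := by
  refine csSup_le ⟨0, x, mem_ball_self hR, by simp⟩ ?_
  rintro t ⟨y, hy, h⟩
  exact le_of_mem_freeRadii hn hγ hR hy h

theorem hFree_le {n : ℕ} (hn : n ≠ 0) (E : Set (EuclideanSpace ℝ (Fin n)))
    (x : EuclideanSpace ℝ (Fin n)) {R : ℝ} (hR : 0 < R) : hFree E x R ≤ R := by
  refine csSup_le ⟨0, x, mem_ball_self hR, by simp⟩ ?_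
  rintro t ⟨y, -, h⟩
  exact le_of_ball_subset_ball hn hR (h.trans sdiff_subset)

theorem hFree_sphereFamily_pos {n : ℕ} (hn : n ≠ 0) {γ R : ℝ} (hγ : 0 < γ)
    (x : EuclideanSpace ℝ (Fin n)) (hR : 0 < R) : 0 < hFree (sphereFamily n γ) x R := by
  obtain ⟨y, hy, hyE⟩ : ∃ y ∈ ball x R, y ∉ sphereFamily n γ := by
    by_contra! hsub
    exact (measure_ball_pos volume x hR).ne'
      (measure_mono_null hsub (volume_sphereFamily (Nat.one_le_iff_ne_zero.2 hn) γ))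
  obtain ⟨t, ht, hball⟩ := Metric.isOpen_iff.1
    (isOpen_ball.sdiff (isClosed_sphereFamily n hγ)) y ⟨hy, hyE⟩
  refine ht.trans_le (le_csSup ⟨R, ?_⟩ ⟨y, hy, hball⟩)
  rintro t ⟨y, -, h⟩
  exact le_of_ball_subset_ball hn hR (h.trans sdiff_subset)

theorem mem_muckSet_sphereFamily {n : ℕ} (hn : n ≠ 0) {γ α : ℝ} (hγ : 0 < γ)
    (hα0 : 0 < α) (hα1 : α ≤ 1) (hα : α * gapExponent γ < n) :
    α ∈ MuckSet (sphereFamily n γ) := by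
  obtain ⟨C, hC, hvol⟩ := volume_thickening_inter_ball_le hn hγ hα0 hα1 hα
  have hω := volume_real_unitBall_pos n
  have hG := one_le_gapConst γ
  set ω := volume.real (ball (0 : EuclideanSpace ℝ (Fin n)) 1) with hωdef
  refine ⟨C * gapConst γ ^ α / ω, fun x _ R r hr hrh hhR => ?_⟩
  have hh := hr.trans hrh
  have hR := hh.trans_le hhR
  have hH := freeScale_pos γ x hR
  have hle := hFree_sphereFamily_le hn hγ x hR
  set h := hFree (sphereFamily n γ) x R with hhdef
  have h1 : r / freeScale γ x R ≤ gapConst γ * (h / r)⁻¹ := by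
    rw [inv_div, mul_div_assoc', div_le_div_iff₀ hH hh]
    nlinarith
  rw [← measureReal_def, ← measureReal_def, volume_real_ball x hR]
  calc volume.real (thickening r (sphereFamily n γ) ∩ ball x R)
      ≤ C * (r / freeScale γ x R) ^ α * R ^ n := hvol x R r hR hr
    _ ≤ C * (gapConst γ * (h / r)⁻¹) ^ α * R ^ n := by gcongr
    _ = C * gapConst γ ^ α / ω * (h / r) ^ (-α) * (R ^ n * ω) := by
      rw [Real.mul_rpow (by positivity) (by positivity), Real.inv_rpow (by positivity),
        Real.rpow_neg (by positivity)]
      field_simp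

theorem le_of_rpow_le_mul_rpow {c K a b r₀ : ℝ} (hc : 0 < c) (hr₀ : 0 < r₀)
    (h : ∀ r, 0 < r → r < r₀ → c * r ^ b ≤ K * r ^ a) : a ≤ b := by
  by_contra! hlt
  have ht : Filter.Tendsto (fun r : ℝ => K * r ^ (a - b)) (nhdsWithin 0 (Ioi 0))
      (nhds (K * 0)) := by
    refine Filter.Tendsto.const_mul K ?_
    have := (Real.continuousAt_rpow_const 0 (a - b) (Or.inr (by linarith))).tendsto
    rw [Real.zero_rpow (by linarith)] at this
    exact this.mono_left nhdsWithin_le_nhds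
  rw [mul_zero] at ht
  refine absurd (ge_of_tendsto ht ?_) hc.not_ge
  filter_upwards [Ioo_mem_nhdsGT hr₀] with r hr
  have hb : 0 < r ^ b := Real.rpow_pos_of_pos hr.1 _
  rw [Real.rpow_sub hr.1, mul_div_assoc', le_div_iff₀ hb]
  exact h r hr.1 hr.2

theorem mul_le_volume_thickening {n : ℕ} (hn : n ≠ 0) {γ r : ℝ} (hr : 0 < r) (hr1 : r ≤ 1) :
    volume.real (ball (0 : EuclideanSpace ℝ (Fin n)) 1) * r ^ (1 : ℝ) ≤
      volume.real (thickening r (sphereFamily n γ) ∩ ball 0 2) := by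
  have hω := volume_real_unitBall_pos n
  have hsub : ball (0 : EuclideanSpace ℝ (Fin n)) (1 + r) \ ball 0 1 ⊆
      thickening r (sphereFamily n γ) ∩ ball 0 2 := by
    rintro y ⟨hy1, hy2⟩
    rw [mem_ball_zero_iff] at hy1 hy2
    have hy : y ≠ 0 := by
      rintro rfl
      simp at hy2
    obtain ⟨e, he, hd⟩ := exists_mem_sphereFamily_dist_eq γ hy 0
    refine ⟨mem_thickening_iff.2 ⟨e, he, ?_⟩, by rw [mem_ball_zero_iff]; linarith⟩
    rw [hd, sphereRadius_zero, abs_of_nonneg (by linarith)]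
    linarith
  refine le_trans ?_ (measureReal_mono hsub
    (measure_ne_top_of_subset inter_subset_right measure_ball_lt_top.ne))
  rw [measureReal_sdiff (ball_subset_ball (by linarith)) measurableSet_ball,
    volume_real_ball 0 (by linarith : 0 < 1 + r), Real.rpow_one]
  have := le_self_pow₀ (by linarith : 1 ≤ 1 + r) hn
  nlinarith

theorem rpow_le_volume_thickening {n : ℕ} {γ r : ℝ} (hγ : 0 < γ) (hr : 0 < r) (hr1 : r ≤ 1) :
    volume.real (ball (0 : EuclideanSpace ℝ (Fin n)) 1) * (2 * gapConst γ)⁻¹ ^ (n / gapExponent γ) *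
        r ^ (n / gapExponent γ) ≤
      volume.real (thickening r (sphereFamily n γ) ∩ ball 0 2) := by
  have hG := one_le_gapConst γ
  have hκ : 0 < gapExponent γ := by linarith [one_lt_gapExponent hγ]
  set ρ := ((2 * gapConst γ)⁻¹ * r) ^ (gapExponent γ)⁻¹ with hρ
  have hρ0 : 0 < ρ := by positivity
  have hρκ : ρ ^ gapExponent γ = (2 * gapConst γ)⁻¹ * r :=
    Real.rpow_inv_rpow (by positivity) hκ.ne'
  have hρ1 : ρ ≤ 1 := by
    refine Real.rpow_le_one (by positivity) ?_ (by positivity)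
    rw [inv_mul_le_iff₀ (by positivity)]
    linarith
  have hsub : ball (0 : EuclideanSpace ℝ (Fin n)) ρ ⊆
      thickening r (sphereFamily n γ) ∩ ball 0 2 := by
    intro y hy
    refine ⟨?_, ball_subset_ball (by linarith) hy⟩
    rw [mem_ball_zero_iff] at hy
    obtain ⟨e, he, hd⟩ := exists_mem_sphereFamily_dist_le hγ y
    refine mem_thickening_iff.2 ⟨e, he, hd.trans_lt ?_⟩
    calc gapConst γ * ‖y‖ ^ gapExponent γ ≤ gapConst γ * ρ ^ gapExponent γ := by gcongr
      _ = r / 2 := by rw [hρκ]; field_simp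
      _ < r := by linarith
  refine le_trans (le_of_eq ?_) (measureReal_mono hsub
    (measure_ne_top_of_subset inter_subset_right measure_ball_lt_top.ne))
  rw [volume_real_ball 0 hρ0, hρ, ← Real.rpow_natCast, ← Real.rpow_mul (by positivity),
    Real.mul_rpow (by positivity) hr.le, inv_mul_eq_div]
  ring

theorem le_of_mem_muckSet_of_le_volume {n : ℕ} (hn : n ≠ 0) {γ α β c : ℝ} (hγ : 0 < γ)
    (hα : α ∈ MuckSet (sphereFamily n γ)) (hc : 0 < c)
    (h : ∀ r, 0 < r → r ≤ 1 →
      c * r ^ β ≤ volume.real (thickening r (sphereFamily n γ) ∩ ball 0 2)) : α ≤ β := by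
  obtain ⟨C, hC⟩ := hα
  have hh := hFree_sphereFamily_pos hn hγ 0 two_pos
  have hh2 := hFree_le hn (sphereFamily n γ) 0 two_pos
  specialize hC 0 (zero_mem_sphereFamily n γ) 2
  set H := hFree (sphereFamily n γ) 0 2 with hH
  refine le_of_rpow_le_mul_rpow hc (lt_min hh one_pos) (K := C * H ^ (-α) * volume.real
    (ball (0 : EuclideanSpace ℝ (Fin n)) 2)) fun r hr hr' => ?_
  refine (h r hr (hr'.le.trans (min_le_right _ _))).trans
    ((hC r hr (hr'.trans_le (min_le_left _ _)) hh2).trans (le_of_eq ?_))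
  rw [Real.div_rpow hh.le hr.le, Real.rpow_neg hr.le, measureReal_def, div_inv_eq_mul]
  ring

theorem muckExp_sphereFamily {n : ℕ} (hn : n ≠ 0) {γ : ℝ} (hγ : 0 < γ) :
    MuckExp (sphereFamily n γ) = min 1 ((n : ℝ) / gapExponent γ) := by
  have hκ : 0 < gapExponent γ := by linarith [one_lt_gapExponent hγ]
  have hω := volume_real_unitBall_pos n
  have hG := one_le_gapConst γ
  have hm : 0 < min 1 ((n : ℝ) / gapExponent γ) := by positivity
  have hmem : ∀ α, 0 < α → α < min 1 ((n : ℝ) / gapExponent γ) →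
      α ∈ MuckSet (sphereFamily n γ) := fun α h0 h1 =>
    mem_muckSet_sphereFamily hn hγ h0 (h1.le.trans (min_le_left _ _))
      ((lt_div_iff₀ hκ).1 (h1.trans_le (min_le_right _ _)))
  have hub : ∀ α ∈ MuckSet (sphereFamily n γ), α ≤ min 1 ((n : ℝ) / gapExponent γ) :=
    fun α hα => le_min
      (le_of_mem_muckSet_of_le_volume hn hγ hα hω fun r h0 h1 => mul_le_volume_thickening hn h0 h1)
      (le_of_mem_muckSet_of_le_volume hn hγ hα (by positivity) fun r h0 h1 =>
        rpow_le_volume_thickening hγ h0 h1)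
  rw [MuckExp, if_pos fun x _ R hR => hFree_sphereFamily_pos hn hγ x hR]
  refine le_antisymm (csSup_le ⟨_, hmem _ (half_pos hm) (half_lt_self hm)⟩ hub)
    (le_of_forall_lt fun b hb => ?_)
  obtain ⟨α, h1, h2⟩ := exists_between (max_lt hb hm)
  exact ((le_max_left _ _).trans_lt h1).trans_le
    (le_csSup ⟨_, hub⟩ (hmem α ((le_max_right _ _).trans_lt h1) h2))

theorem not_porous_sphereFamily (n : ℕ) {γ : ℝ} (hγ : 0 < γ) : ¬ Porous (sphereFamily n γ) := by
  rintro ⟨c, hc, h⟩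
  refine (one_lt_gapExponent hγ).not_ge
    (le_of_rpow_le_mul_rpow hc one_pos (K := gapConst γ) fun r hr _ => ?_)
  obtain ⟨y, hy⟩ := h 0 r hr
  have hyr := (hy (mem_ball_self (by positivity))).1
  rw [mem_ball_zero_iff] at hyr
  rw [Real.rpow_one]
  exact le_of_ball_disjoint_sphereFamily hγ hyr.le (disjoint_sdiff_left.mono_left hy)

namespace Cube

variable {n : ℕ}

theorem set_eq_preimage (P : Cube n) :
    P.set = WithLp.ofLp ⁻¹' (pi univ fun i => Ico (P.a i) (P.a i + P.l)) := by
  ext x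
  simp [Cube.set]

theorem volume_real_set (P : Cube n) : volume.real P.set = P.l ^ n := by
  rw [set_eq_preimage, measureReal_def, (PiLp.volume_preserving_ofLp (Fin n)).measure_preimage
    (MeasurableSet.univ_pi fun _ => measurableSet_Ico).nullMeasurableSet,
    Real.volume_pi_Ico_toReal fun i => by simpa using P.pos.le]
  simp

theorem dist_le_of_mem {P : Cube n} {x y : EuclideanSpace ℝ (Fin n)} (hx : x ∈ P.set)
    (hy : y ∈ P.set) : dist x y ≤ n * P.l := by
  have hl := P.pos
  rw [EuclideanSpace.dist_eq]
  refine Real.sqrt_le_iff.2 ⟨by positivity, ?_⟩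
  have h : ∀ i ∈ Finset.univ, dist (x i) (y i) ^ 2 ≤ P.l ^ 2 := fun i _ => by
    refine pow_le_pow_left₀ dist_nonneg ?_ 2
    rw [Real.dist_eq, abs_le]
    constructor <;> linarith [(hx i).1, (hx i).2, (hy i).1, (hy i).2]
  have hs := Finset.sum_le_card_nsmul _ _ _ h
  rw [Finset.card_univ, Fintype.card_fin, nsmul_eq_mul] at hs
  refine hs.trans ?_
  rw [mul_pow]
  have : (n : ℝ) ≤ n ^ 2 := by exact_mod_cast Nat.le_self_pow two_ne_zero n
  gcongr

theorem a_mem_set (P : Cube n) : P.a ∈ P.set := fun i => ⟨le_rfl, by linarith [P.pos]⟩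

theorem exists_ball_subset_set (P : Cube n) : ∃ z ∈ P.set, ball z (P.l / 2) ⊆ P.set := by
  have hl := P.pos
  refine ⟨WithLp.toLp 2 fun i => P.a i + P.l / 2, fun i => ?_, fun y hy i => ?_⟩
  · constructor <;> simp only <;> linarith
  · have h1 : |y i - (P.a i + P.l / 2)| < P.l / 2 := by
      rw [mem_ball, dist_eq_norm] at hy
      exact (PiLp.norm_apply_le _ i).trans_lt hy
    have := abs_lt.1 h1
    constructor <;> linarith

/-- The dyadic subcube of `P` of generation `j` with multi-index `k`. -/
noncomputable def dyadic (P : Cube n) (j : ℕ) (k : Fin n → ℕ) : Cube n where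
  a := WithLp.toLp 2 fun i => P.a i + P.l * k i / 2 ^ j
  l := P.l / 2 ^ j
  pos := div_pos P.pos (by positivity)

theorem isDyadicSubcube_dyadic (P : Cube n) (j : ℕ) {k : Fin n → ℕ} (hk : ∀ i, k i < 2 ^ j) :
    IsDyadicSubcube P (P.dyadic j k) :=
  ⟨j, k, hk, rfl, fun _ => rfl⟩

theorem mem_dyadic_iff {P : Cube n} {j : ℕ} {k : Fin n → ℕ} {x : EuclideanSpace ℝ (Fin n)} :
    x ∈ (P.dyadic j k).set ↔
      ∀ i, (k i : ℝ) ≤ (x i - P.a i) / (P.l / 2 ^ j) ∧ (x i - P.a i) / (P.l / 2 ^ j) < k i + 1 := by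
  have hl : 0 < P.l / 2 ^ j := div_pos P.pos (by positivity)
  refine forall_congr' fun i => ?_
  rw [le_div_iff₀ hl, div_lt_iff₀ hl]
  simp only [dyadic, mul_div_right_comm]
  constructor <;> rintro ⟨h1, h2⟩ <;> constructor <;> linarith

theorem disjoint_dyadic (P : Cube n) (j : ℕ) {k k' : Fin n → ℕ} (h : k ≠ k') :
    Disjoint (P.dyadic j k).set (P.dyadic j k').set := by
  refine disjoint_left.2 fun x hx hx' => h (funext fun i => ?_)
  have h1 := mem_dyadic_iff.1 hx i
  have h2 := mem_dyadic_iff.1 hx' i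
  have h3 : (k i : ℝ) < k' i + 1 := h1.1.trans_lt h2.2
  have h4 : (k' i : ℝ) < k i + 1 := h2.1.trans_lt h1.2
  norm_cast at h3 h4
  omega

theorem exists_mem_dyadic (P : Cube n) (j : ℕ) {x : EuclideanSpace ℝ (Fin n)} (hx : x ∈ P.set) :
    ∃ k : Fin n → Fin (2 ^ j), x ∈ (P.dyadic j fun i => k i).set := by
  have hl : 0 < P.l / 2 ^ j := div_pos P.pos (by positivity)
  have h0 (i) : 0 ≤ (x i - P.a i) / (P.l / 2 ^ j) := div_nonneg (by linarith [(hx i).1]) hl.le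
  refine ⟨fun i => ⟨⌊(x i - P.a i) / (P.l / 2 ^ j)⌋₊, ?_⟩, mem_dyadic_iff.2 fun i =>
    ⟨Nat.floor_le (h0 i), Nat.lt_floor_add_one _⟩⟩
  rw [Nat.floor_lt (h0 i), div_lt_iff₀ hl, Nat.cast_pow, Nat.cast_ofNat,
    mul_div_cancel₀ _ (by positivity)]
  linarith [(hx i).2]

end Cube

theorem IsDyadicSubcube.subset {n : ℕ} {P Q : Cube n} (h : IsDyadicSubcube P Q) :
    Q.set ⊆ P.set := by
  obtain ⟨j, k, hk, hl, ha⟩ := h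
  intro x hx i
  have hP := P.pos
  have h2 : (0 : ℝ) < 2 ^ j := by positivity
  have hki : (k i : ℝ) + 1 ≤ 2 ^ j := by exact_mod_cast hk i
  obtain ⟨h1, h3⟩ := hx i
  rw [ha i] at h1 h3
  rw [hl] at h3
  have h4 : 0 ≤ P.l * k i / 2 ^ j := by positivity
  have h5 : P.l * k i / 2 ^ j + P.l / 2 ^ j ≤ P.l := by
    rw [← add_div, div_le_iff₀ h2]
    nlinarith
  constructor <;> linarith

theorem exists_div_two_pow_near {A R : ℝ} (hA : 0 < A) (hAR : A ≤ R) :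
    ∃ j : ℕ, A / 2 ≤ R / 2 ^ j ∧ R / 2 ^ j ≤ A := by
  obtain ⟨j, h1, h2⟩ := exists_nat_pow_near ((one_le_div hA).2 hAR) one_lt_two
  rw [le_div_iff₀ hA] at h1
  rw [div_lt_iff₀ hA] at h2
  have h3 : (0 : ℝ) < 2 ^ j := by positivity
  refine ⟨j + 1, ?_, ?_⟩
  · rw [le_div_iff₀ (by positivity), pow_succ]
    linarith
  · rw [div_le_iff₀ (by positivity)]
    linarith

theorem maxFree_sphereFamily_le {n : ℕ} (hn : n ≠ 0) {γ R : ℝ} (hγ : 0 < γ) {P : Cube n}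
    (hR : 0 < R) (hP : P.set ⊆ ball P.a R) :
    maxFree (sphereFamily n γ) P ≤ (2 * gapConst γ * freeScale γ P.a R) ^ n := by
  have hG := one_le_gapConst γ
  have hH := freeScale_pos γ P.a hR
  refine Real.sSup_le ?_ (by positivity)
  rintro _ ⟨Q, hQ, hfree, rfl⟩
  obtain ⟨z, hz, hball⟩ := Q.exists_ball_subset_set
  have hQP := hQ.subset.trans hP
  have h : Q.l / 2 ≤ gapConst γ * freeScale γ P.a R :=
    le_of_mem_freeRadii hn hγ hR (hQP hz) (subset_sdiff.2 ⟨hball.trans hQP,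
      (disjoint_iff_inter_eq_empty.2 hfree).mono_left hball⟩)
  have hQl := Q.pos
  rw [← measureReal_def, Q.volume_real_set]
  gcongr
  linarith

theorem weaklyPorousWith_of_dyadic {n : ℕ} {E : Set (EuclideanSpace ℝ (Fin n))} {c δ : ℝ}
    (h : ∀ P : Cube n, ∃ j : ℕ, δ * maxFree E P ≤ (P.l / 2 ^ j) ^ n ∧
      c * P.l ^ n + volume.real (thickening (2 * n * P.l / 2 ^ j) E ∩ P.set) ≤ P.l ^ n)
    (hn : n ≠ 0) : WeaklyPorousWith E c δ := by
  classical
  intro P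
  obtain ⟨j, hmax, hvol⟩ := h P
  have hl := P.pos
  set F : Finset (Fin n → Fin (2 ^ j)) := {k | EFree E (P.dyadic j fun i => k i)} with hF
  let e := F.equivFin.symm
  refine ⟨F.card, fun m => P.dyadic j fun i => (e m).1 i, fun m => ⟨?_, ?_⟩, fun m m' hne => ?_,
    fun m => ?_, ?_⟩
  · exact P.isDyadicSubcube_dyadic j fun i => ((e m).1 i).2
  · exact (Finset.mem_filter.1 (e m).2).2
  · refine P.disjoint_dyadic j fun heq => hne (e.injective (Subtype.ext (funext fun i => ?_)))
    exact Fin.ext (congrFun heq i)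
  · rw [← measureReal_def, Cube.volume_real_set]
    exact hmax
  · have hsub : P.set ⊆ (⋃ k ∈ F, (P.dyadic j fun i => k i).set) ∪
        (thickening (2 * n * P.l / 2 ^ j) E ∩ P.set) := by
      intro x hx
      obtain ⟨k, hk⟩ := P.exists_mem_dyadic j hx
      by_cases hkF : k ∈ F
      · exact Or.inl (mem_iUnion₂.2 ⟨k, hkF, hk⟩)
      · right
        have hne : ((P.dyadic j fun i => k i).set ∩ E).Nonempty := by
          rw [nonempty_iff_ne_empty]
          exact fun h0 => hkF (Finset.mem_filter.2 ⟨Finset.mem_univ _, h0⟩)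
        obtain ⟨y, hy, hyE⟩ := hne
        refine ⟨mem_thickening_iff.2 ⟨y, hyE, (Cube.dist_le_of_mem hk hy).trans_lt ?_⟩, hx⟩
        have : 0 < n * (P.l / 2 ^ j) := by positivity
        calc n * (P.l / 2 ^ j) < 2 * (n * (P.l / 2 ^ j)) := by linarith
          _ = _ := by ring
    have hfinQ (Q : Cube n) : volume Q.set ≠ ⊤ := by
      refine measure_ne_top_of_subset (s := closedBall Q.a (n * Q.l)) (fun x hx => ?_)
        (measure_closedBall_lt_top (μ := volume)).ne
      exact Cube.dist_le_of_mem hx Q.a_mem_set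
    have h1 := (measureReal_mono hsub (measure_union_ne_top
      (measure_biUnion_lt_top F.finite_toSet fun k _ => (hfinQ _).lt_top).ne
      (measure_ne_top_of_subset inter_subset_right (hfinQ P)))).trans (measureReal_union_le _ _)
    have h2 := measureReal_biUnion_finset_le (μ := volume) F
      fun k => (P.dyadic j fun i => k i).set
    have h3 : ∑ k ∈ F, volume.real (P.dyadic j fun i => k i).set =
        ∑ m, volume.real (P.dyadic j fun i => (e m).1 i).set := by
      rw [← Finset.sum_coe_sort F, ← e.sum_comp]
    simp only [← measureReal_def]
    rw [P.volume_real_set] at h1 ⊢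
    linarith

theorem weaklyPorous_sphereFamily {n : ℕ} (hn : n ≠ 0) {γ : ℝ} (hγ : 0 < γ) :
    WeaklyPorous (sphereFamily n γ) := by
  have hκ : 0 < gapExponent γ := by linarith [one_lt_gapExponent hγ]
  have hG := one_le_gapConst γ
  have hn1 : (1 : ℝ) ≤ n := by exact_mod_cast Nat.one_le_iff_ne_zero.2 hn
  obtain ⟨α, hα0, hαm⟩ := exists_between
    (by positivity : 0 < min 1 ((n : ℝ) / gapExponent γ))
  obtain ⟨C, hC, hvol⟩ := volume_thickening_inter_ball_le hn hγ hα0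
    (hαm.le.trans (min_le_left _ _)) ((lt_div_iff₀ hκ).1 (hαm.trans_le (min_le_right _ _)))
  set D : ℝ := 2 * (C * (2 * n) ^ n) with hD
  have hD0 : 0 < D := by positivity
  set ε : ℝ := min 1 (D⁻¹ ^ α⁻¹) with hε
  have hε0 : 0 < ε := by positivity
  have hε1 : ε ≤ 1 := min_le_left _ _
  have hεα : ε ^ α ≤ D⁻¹ := by
    calc ε ^ α ≤ (D⁻¹ ^ α⁻¹) ^ α := Real.rpow_le_rpow hε0.le (min_le_right _ _) hα0.le
      _ = D⁻¹ := Real.rpow_inv_rpow (by positivity) hα0.ne'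
  refine ⟨1 / 2, (ε / (8 * n * gapConst γ)) ^ n, by norm_num, by norm_num, by positivity,
    pow_lt_one₀ (by positivity) ?_ hn, weaklyPorousWith_of_dyadic (fun P => ?_) hn⟩
  · rw [div_lt_one (by positivity)]
    nlinarith
  have hl := P.pos
  set R : ℝ := 2 * n * P.l with hRdef
  have hR : 0 < R := by positivity
  have hP : P.set ⊆ ball P.a R := fun x hx => by
    have : 0 < n * P.l := by positivity
    refine (Cube.dist_le_of_mem hx P.a_mem_set).trans_lt ?_
    rw [hRdef]
    linarith
  have hH := freeScale_pos γ P.a hR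
  have hHR := freeScale_le γ P.a R
  have hmax := maxFree_sphereFamily_le hn hγ hR hP
  set H := freeScale γ P.a R with hHdef
  obtain ⟨j, hj1, hj2⟩ := exists_div_two_pow_near (by positivity : 0 < ε * H)
    (by nlinarith : ε * H ≤ R)
  have hr : 0 < R / 2 ^ j := by positivity
  refine ⟨j, ?_, ?_⟩
  · calc (ε / (8 * n * gapConst γ)) ^ n * maxFree (sphereFamily n γ) P
        ≤ (ε / (8 * n * gapConst γ)) ^ n * (2 * gapConst γ * H) ^ n := by gcongr
      _ = (ε * H / 2 / (2 * n)) ^ n := by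
        rw [← mul_pow]
        congr 1
        field_simp
        norm_num
      _ ≤ (R / 2 ^ j / (2 * n)) ^ n := by gcongr
      _ = (P.l / 2 ^ j) ^ n := by
        congr 1
        rw [hRdef]
        field_simp
  · have h1 : volume.real (thickening (R / 2 ^ j) (sphereFamily n γ) ∩ P.set) ≤ P.l ^ n / 2 :=
      calc volume.real (thickening (R / 2 ^ j) (sphereFamily n γ) ∩ P.set)
          ≤ volume.real (thickening (R / 2 ^ j) (sphereFamily n γ) ∩ ball P.a R) :=
            measureReal_mono (inter_subset_inter_right _ hP)
              (measure_ne_top_of_subset inter_subset_right measure_ball_lt_top.ne)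
        _ ≤ C * (R / 2 ^ j / H) ^ α * R ^ n := hvol P.a R _ hR hr
        _ ≤ C * ε ^ α * R ^ n := by
            gcongr
            exact (div_le_iff₀ hH).2 hj2
        _ ≤ C * D⁻¹ * R ^ n := by gcongr
        _ = P.l ^ n / 2 := by
            rw [hD, hRdef, mul_pow (2 * (n : ℝ))]
            field_simp
    linarith

/-- For `γ > 0` and `n ≥ 1`, the set
`E = ⋃_{j≥1} ∂B(0, j^{-γ}) ∪ {0} ⊆ ℝⁿ` is weakly porous,
`Mu(E) = min{1, nγ/(1+γ)}`, and `E` is not porous. -/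
theorem sphereFamily_weaklyPorous_muckExp (n : ℕ) (hn : 1 ≤ n) (γ : ℝ) (hγ : 0 < γ) :
    WeaklyPorous (sphereFamily n γ) ∧
      MuckExp (sphereFamily n γ) = min 1 ((n : ℝ) * γ / (1 + γ)) ∧
      ¬ Porous (sphereFamily n γ) := by
  have hn0 : n ≠ 0 := by omega
  refine ⟨weaklyPorous_sphereFamily hn0 hγ, ?_, not_porous_sphereFamily n hγ⟩
  rw [muckExp_sphereFamily hn0 hγ, gapExponent, div_div_eq_mul_div]
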